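/- Fix n ∈ ℤ and m ∈ ℂ with m ∉ ℤ, and set Θ₀ = n + m, Θ∞ = m − n + 1. Then the generic Painlevé-III equation with parameters (Θ₀, Θ∞) has exactly two rational solutions: there exist two distinct rational functions u₁ ≠ u₂, each a rational solution, such that every rational solution equals u₁ or u₂ (as a rational function); moreover u₂(x) = −u₁(−x). -/

import Mathlib

open Complex Polynomial Filter

/-- The generic Painlevé-III equation with parameters `(Θ0, Θinf)` holds for the
function `u` at the point `x`. -/
def PIIIat (Θ0 Θinf : ℂ) (u : ℂ → ℂ) (x : ℂ) : Prop :=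
  deriv (deriv u) x =
    (deriv u x) ^ 2 / u x - deriv u x / x
      + (4 * Θ0 * (u x) ^ 2 + 4 * (1 - Θinf)) / x
      + 4 * (u x) ^ 3 - 4 / u x

/-- The rational function `p/q` is a rational solution of the generic Painlevé-III
equation with parameters `(Θ0, Θinf)`. -/
def IsRatSolutionPIII (Θ0 Θinf : ℂ) (p q : Polynomial ℂ) : Prop :=
  p ≠ 0 ∧ q ≠ 0 ∧ ∀ x : ℂ, x ≠ 0 → p.eval x ≠ 0 → q.eval x ≠ 0 →
    PIIIat Θ0 Θinf (fun y => p.eval y / q.eval y) x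

/-- The polynomial obtained from the Painlevé-III equation with coefficients `α` and `β` for `p/q`
by clearing denominators. -/
noncomputable def piiiPoly (α β : ℂ) (p q : ℂ[X]) : ℂ[X] :=
  X * ((derivative (derivative p) * p - derivative p ^ 2) * q ^ 2
      - (derivative (derivative q) * q - derivative q ^ 2) * p ^ 2)
    + p * q * (derivative p * q - derivative q * p)
    - (C α * p ^ 3 * q + C β * p * q ^ 3 + 4 * X * (p ^ 4 - q ^ 4))

/-- The Hirota square of the Euler operator `X * d/dX`. -/
noncomputable def eulerHirota (p : ℂ[X]) : ℂ[X] :=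
  p * (X * derivative (X * derivative p)) - (X * derivative p) ^ 2

lemma X_mul_piiiPoly (α β : ℂ) (p q : ℂ[X]) :
    X * piiiPoly α β p q = eulerHirota p * q ^ 2 - eulerHirota q * p ^ 2
      - X * (C α * p ^ 3 * q + C β * p * q ^ 3) - 4 * X ^ 2 * (p ^ 4 - q ^ 4) := by
  simp only [piiiPoly, eulerHirota, derivative_mul, derivative_X]
  ring

lemma piiiPoly_mul_left (α β : ℂ) (g p q : ℂ[X]) :
    piiiPoly α β (g * p) (g * q) = g ^ 4 * piiiPoly α β p q := by
  simp only [piiiPoly, derivative_mul, derivative_add]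
  ring

lemma piiiPoly_swap (α β : ℂ) (p q : ℂ[X]) :
    piiiPoly α β q p = -piiiPoly (-β) (-α) p q := by
  simp only [piiiPoly, C_neg]
  ring

lemma piiiPoly_neg_comp (α β : ℂ) (p q : ℂ[X]) :
    piiiPoly α β (-(p.comp (-X))) (q.comp (-X)) = -(piiiPoly α β p q).comp (-X) := by
  simp only [piiiPoly, derivative_neg, derivative_comp, derivative_mul, derivative_X, derivative_one,
    sub_comp, add_comp, mul_comp, pow_comp, X_comp, C_comp, ofNat_comp]
  ring

lemma natDegree_sub_le_of_degree_le {p q : ℂ[X]} {d : ℕ} (hp : p.natDegree ≤ d)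
    (hq : q.natDegree ≤ d) : (p - q).natDegree ≤ d :=
  (natDegree_sub_le p q).trans (max_le hp hq)

lemma natDegree_X_mul_derivative_le (p : ℂ[X]) : (X * derivative p).natDegree ≤ p.natDegree := by
  rcases Nat.eq_zero_or_pos p.natDegree with h | h
  · rw [eq_C_of_natDegree_eq_zero h]; simp
  · refine natDegree_mul_le.trans ?_
    have := natDegree_derivative_le p
    have := natDegree_X_le (R := ℂ)
    omega

lemma natDegree_X_mul_derivative_le_of_le {p : ℂ[X]} {d : ℕ} (h : p.natDegree ≤ d) :
    (X * derivative p).natDegree ≤ d :=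
  (natDegree_X_mul_derivative_le p).trans h

lemma natDegree_eulerHirota_le {p : ℂ[X]} {d : ℕ} (h : p.natDegree ≤ d) :
    (eulerHirota p).natDegree ≤ 2 * d := by
  have h1 := natDegree_X_mul_derivative_le_of_le h
  have h2 := natDegree_X_mul_derivative_le_of_le h1
  have h3 := natDegree_mul_le_of_le h h2
  have h4 := natDegree_pow_le_of_le 2 h1
  exact natDegree_sub_le_of_degree_le (by omega) h4

lemma coeff_eq_zero_of_X_mul_eq {R S : ℂ[X]} {N : ℕ} (h : X * R = S) (hS : S.natDegree ≤ N) :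
    R.coeff N = 0 := by
  rw [← coeff_X_mul, h]
  exact coeff_eq_zero_of_natDegree_lt (by omega)

/-- Near infinity a rational solution tends to a fourth root of unity. -/
lemma natDegree_eq_and_leadingCoeff_pow_four_eq {α β : ℂ} {p q : ℂ[X]} (hp : p ≠ 0) (hq : q ≠ 0)
    (h : piiiPoly α β p q = 0) :
    p.natDegree = q.natDegree ∧ p.leadingCoeff ^ 4 = q.leadingCoeff ^ 4 := by
  obtain ⟨d, hd⟩ : ∃ d, d = max p.natDegree q.natDegree := ⟨_, rfl⟩
  have hpd : p.natDegree ≤ d := by omega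
  have hqd : q.natDegree ≤ d := by omega
  have key : X * (4 * (X * (p ^ 4 - q ^ 4)) + (C α * p ^ 3 * q + C β * p * q ^ 3)) =
      eulerHirota p * q ^ 2 - eulerHirota q * p ^ 2 := by
    have := X_mul_piiiPoly α β p q
    rw [h] at this
    linear_combination this
  have hdeg : (eulerHirota p * q ^ 2 - eulerHirota q * p ^ 2).natDegree ≤ 4 * d + 1 := by
    have h1 := natDegree_mul_le_of_le (natDegree_eulerHirota_le hpd) (natDegree_pow_le_of_le 2 hqd)
    have h2 := natDegree_mul_le_of_le (natDegree_eulerHirota_le hqd) (natDegree_pow_le_of_le 2 hpd)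
    exact natDegree_sub_le_of_degree_le (by omega) (by omega)
  have hlow : (C α * p ^ 3 * q + C β * p * q ^ 3).natDegree < 4 * d + 1 := by
    have h1 := natDegree_mul_le_of_le (natDegree_mul_le_of_le (natDegree_C α).le
      (natDegree_pow_le_of_le 3 hpd)) hqd
    have h2 := natDegree_mul_le_of_le (natDegree_mul_le_of_le (natDegree_C β).le
      hpd) (natDegree_pow_le_of_le 3 hqd)
    exact (natDegree_add_le_of_degree_le (n := 4 * d) (by omega) (by omega)).trans_lt (by omega)
  have hc := coeff_eq_zero_of_X_mul_eq key hdeg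
  rw [coeff_add, coeff_eq_zero_of_natDegree_lt hlow, coeff_ofNat_mul, coeff_X_mul, coeff_sub,
    coeff_pow_of_natDegree_le hpd, coeff_pow_of_natDegree_le hqd] at hc
  have hc' : p.coeff d ^ 4 = q.coeff d ^ 4 := by linear_combination hc / 4
  have hne : p.coeff d ≠ 0 ∧ q.coeff d ≠ 0 := by
    rcases le_total p.natDegree q.natDegree with hle | hle
    · have : q.coeff d ≠ 0 := by
        rw [hd, max_eq_right hle]; exact leadingCoeff_ne_zero.2 hq
      exact ⟨fun h0 => this (by simpa [h0] using hc'.symm), this⟩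
    · have : p.coeff d ≠ 0 := by
        rw [hd, max_eq_left hle]; exact leadingCoeff_ne_zero.2 hp
      exact ⟨this, fun h0 => this (by simpa [h0] using hc')⟩
  have e1 := le_antisymm hpd (le_natDegree_of_ne_zero hne.1)
  have e2 := le_antisymm hqd (le_natDegree_of_ne_zero hne.2)
  exact ⟨e1.trans e2.symm, by rw [leadingCoeff, leadingCoeff, e1, e2, hc']⟩

lemma geom_sum_natDegree_le_and_coeff {f g : ℂ[X]} {c : ℂ} {d : ℕ} (hf : f.natDegree ≤ d)
    (hg : g.natDegree ≤ d) (hfc : f.coeff d = c) (hgc : g.coeff d = c) :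
    (f ^ 3 + f ^ 2 * g + f * g ^ 2 + g ^ 3).natDegree ≤ 3 * d ∧
      (f ^ 3 + f ^ 2 * g + f * g ^ 2 + g ^ 3).coeff (3 * d) = 4 * c ^ 3 := by
  have e1 : 3 * d = 2 * d + d := by ring
  have e2 : 3 * d = d + 2 * d := by ring
  constructor
  · refine natDegree_add_le_of_degree_le (natDegree_add_le_of_degree_le
      (natDegree_add_le_of_degree_le (natDegree_pow_le_of_le 3 hf) ?_) ?_)
      (natDegree_pow_le_of_le 3 hg)
    · exact (natDegree_mul_le_of_le (natDegree_pow_le_of_le 2 hf) hg).trans e1.ge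
    · exact (natDegree_mul_le_of_le hf (natDegree_pow_le_of_le 2 hg)).trans e2.ge
  · have c2 : (f ^ 2 * g).coeff (3 * d) = c ^ 3 := by
      rw [e1, coeff_mul_add_eq_of_natDegree_le (natDegree_pow_le_of_le 2 hf) hg,
        coeff_pow_of_natDegree_le hf, hfc, hgc]; ring
    have c3 : (f * g ^ 2).coeff (3 * d) = c ^ 3 := by
      rw [e2, coeff_mul_add_eq_of_natDegree_le hf (natDegree_pow_le_of_le 2 hg),
        coeff_pow_of_natDegree_le hg, hfc, hgc]; ring
    rw [coeff_add, coeff_add, coeff_add, coeff_pow_of_natDegree_le hf, c2, c3,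
      coeff_pow_of_natDegree_le hg, hfc, hgc]
    ring

lemma eq_of_piiiPoly_eq_zero_of_coeff_eq {α β c : ℂ} {f g h : ℂ[X]} {d : ℕ} (hf : f.natDegree ≤ d)
    (hg : g.natDegree ≤ d) (hh : h.natDegree ≤ d) (hc : c ≠ 0) (hfc : f.coeff d = c)
    (hgc : g.coeff d = c) (hf0 : piiiPoly α β f h = 0) (hg0 : piiiPoly α β g h = 0) : f = g := by
  by_contra hne
  obtain ⟨w, rfl⟩ : ∃ w, f = g + w := ⟨f - g, by ring⟩
  have hw0 : w ≠ 0 := by rintro rfl; simp at hne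
  obtain ⟨e, he⟩ : ∃ e, e = w.natDegree := ⟨_, rfl⟩
  have hw : w.natDegree ≤ e := he.ge
  have key : X * (4 * (X * (w * ((g + w) ^ 3 + (g + w) ^ 2 * g + (g + w) * g ^ 2 + g ^ 3))) +
      (C α * (w * ((g + w) ^ 2 + (g + w) * g + g ^ 2) * h) + C β * (w * h ^ 3))) =
      (w * (X * derivative (X * derivative (g + w))) + g * (X * derivative (X * derivative w))
        - X * derivative w * (X * derivative (g + w) + X * derivative g)) * h ^ 2
        - eulerHirota h * (w * ((g + w) + g)) := by
    have h1 := X_mul_piiiPoly α β (g + w) h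
    have h2 := X_mul_piiiPoly α β g h
    rw [hf0] at h1
    rw [hg0] at h2
    simp only [eulerHirota, derivative_add, mul_add] at h1 h2 ⊢
    linear_combination h1 - h2
  have hdeg : ((w * (X * derivative (X * derivative (g + w)))
        + g * (X * derivative (X * derivative w))
        - X * derivative w * (X * derivative (g + w) + X * derivative g)) * h ^ 2
        - eulerHirota h * (w * ((g + w) + g))).natDegree ≤ (e + 3 * d) + 1 := by
    have f1 := natDegree_X_mul_derivative_le_of_le hf
    have g1 := natDegree_X_mul_derivative_le_of_le hg
    have w1 := natDegree_X_mul_derivative_le_of_le hw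
    have t1 := natDegree_mul_le_of_le hw (natDegree_X_mul_derivative_le_of_le f1)
    have t2 := natDegree_mul_le_of_le hg (natDegree_X_mul_derivative_le_of_le w1)
    have t3 := natDegree_mul_le_of_le w1 (natDegree_add_le_of_degree_le f1 g1)
    have t4 := natDegree_sub_le_of_degree_le
      (natDegree_add_le_of_degree_le t1 (t2.trans (by omega))) t3
    have t5 := natDegree_mul_le_of_le t4 (natDegree_pow_le_of_le 2 hh)
    have t6 := natDegree_mul_le_of_le (natDegree_eulerHirota_le hh)
      (natDegree_mul_le_of_le hw (natDegree_add_le_of_degree_le hf hg))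
    exact natDegree_sub_le_of_degree_le (t5.trans (by omega)) (t6.trans (by omega))
  have hlow : (C α * (w * ((g + w) ^ 2 + (g + w) * g + g ^ 2) * h) + C β * (w * h ^ 3)).natDegree
      < (e + 3 * d) + 1 := by
    have t1 := natDegree_add_le_of_degree_le (n := 2 * d) (natDegree_add_le_of_degree_le
      (natDegree_pow_le_of_le 2 hf) ((natDegree_mul_le_of_le hf hg).trans (by omega)))
      (natDegree_pow_le_of_le 2 hg)
    have t2 := natDegree_mul_le_of_le (natDegree_C α).le
      (natDegree_mul_le_of_le (natDegree_mul_le_of_le hw t1) hh)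
    have t3 := natDegree_mul_le_of_le (natDegree_C β).le
      (natDegree_mul_le_of_le hw (natDegree_pow_le_of_le 3 hh))
    exact (natDegree_add_le_of_degree_le (n := e + 3 * d) (t2.trans (by omega))
      (t3.trans (by omega))).trans_lt (by omega)
  obtain ⟨h3, hc3⟩ := geom_sum_natDegree_le_and_coeff hf hg hfc hgc
  have hz := coeff_eq_zero_of_X_mul_eq key hdeg
  rw [coeff_add, coeff_eq_zero_of_natDegree_lt hlow, coeff_ofNat_mul, coeff_X_mul,
    coeff_mul_add_eq_of_natDegree_le hw h3, hc3, he] at hz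
  exact hw0 (by simpa [hc] using hz)

/-- A rational solution is determined by its limit at infinity. -/
lemma mul_eq_mul_of_leadingCoeff {α β c : ℂ} {p q P Q : ℂ[X]} (hq : q ≠ 0) (hQ : Q ≠ 0)
    (hc : c ≠ 0) (hd : p.natDegree = q.natDegree) (hD : P.natDegree = Q.natDegree)
    (hl : p.leadingCoeff = c * q.leadingCoeff) (hL : P.leadingCoeff = c * Q.leadingCoeff)
    (h : piiiPoly α β p q = 0) (H : piiiPoly α β P Q = 0) : p * Q = P * q := by
  refine eq_of_piiiPoly_eq_zero_of_coeff_eq (h := q * Q) (d := q.natDegree + Q.natDegree)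
    (α := α) (β := β) (c := c * (q.leadingCoeff * Q.leadingCoeff))
    (natDegree_mul_le_of_le hd.le le_rfl)
    ((natDegree_mul_le_of_le hD.le le_rfl).trans (by omega)) natDegree_mul_le ?_ ?_ ?_ ?_ ?_
  · simp [hc, hq, hQ]
  · rw [coeff_mul_add_eq_of_natDegree_le hd.le le_rfl, ← hd]
    change p.leadingCoeff * Q.leadingCoeff = _
    rw [hl]; ring
  · rw [add_comm, coeff_mul_add_eq_of_natDegree_le hD.le le_rfl, ← hD]
    change P.leadingCoeff * q.leadingCoeff = _
    rw [hL]; ring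
  · rw [mul_comm p, mul_comm q, piiiPoly_mul_left, h, mul_zero]
  · rw [mul_comm P, piiiPoly_mul_left, H, mul_zero]

lemma natDegree_X_mul_sub_le {p s : ℂ[X]} {d : ℕ} (hp : p.natDegree ≤ d) (hs : s.natDegree ≤ d)
    (h : p.coeff d = s.coeff d) : (X * (p - s)).natDegree ≤ d := by
  rcases eq_or_ne (p - s) 0 with h0 | h0
  · simp [h0]
  · have h1 := natDegree_sub_le_of_degree_le hp hs
    have h2 : (p - s).natDegree ≠ d := by
      intro h3
      apply leadingCoeff_ne_zero.2 h0
      rw [leadingCoeff, h3, coeff_sub, h, sub_self]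
    rw [natDegree_X_mul h0]
    omega

/-- The coefficient of `1/x` in the expansion at infinity of a rational solution. -/
lemma coeff_X_mul_sub_of_piiiPoly_eq_zero {α β c : ℂ} {p q : ℂ[X]} (hq : q ≠ 0) (hc : c ^ 4 = 1)
    (hd : p.natDegree = q.natDegree) (hl : p.leadingCoeff = c * q.leadingCoeff)
    (h : piiiPoly α β p q = 0) :
    16 * c ^ 3 * (X * (p - C c * q)).coeff q.natDegree
      + (α * c ^ 3 + β * c) * q.leadingCoeff = 0 := by
  obtain ⟨d, hqd⟩ : ∃ d, d = q.natDegree := ⟨_, rfl⟩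
  have hq' : q.natDegree ≤ d := hqd.ge
  have hp' : p.natDegree ≤ d := by omega
  have hql : q.coeff d = q.leadingCoeff := by rw [hqd]; rfl
  have hpl : p.coeff d = c * q.leadingCoeff := by rw [hqd, ← hd]; exact hl
  obtain ⟨s, hs⟩ : ∃ s, s = C c * q := ⟨_, rfl⟩
  have hs' : s.natDegree ≤ d := hs ▸ (natDegree_C_mul_le _ _).trans hq'
  have hsl : s.coeff d = c * q.leadingCoeff := by rw [hs, coeff_C_mul, hql]
  have hs4 : s ^ 4 = q ^ 4 := by
    rw [hs, mul_pow, ← C_pow, hc]; simp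
  rw [← hqd, ← hs]
  have hr : (X * (p - s)).natDegree ≤ d := natDegree_X_mul_sub_le hp' hs' (hpl.trans hsl.symm)
  have key : X * (4 * (X * (p - s) * (p ^ 3 + p ^ 2 * s + p * s ^ 2 + s ^ 3)) +
      (C α * (p ^ 3 * q) + C β * (p * q ^ 3))) =
      eulerHirota p * q ^ 2 - eulerHirota q * p ^ 2 := by
    have := X_mul_piiiPoly α β p q
    rw [h] at this
    linear_combination this - 4 * X ^ 2 * hs4
  have hdeg : (eulerHirota p * q ^ 2 - eulerHirota q * p ^ 2).natDegree ≤ d + 3 * d := by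
    have h1 := natDegree_mul_le_of_le (natDegree_eulerHirota_le hp') (natDegree_pow_le_of_le 2 hq')
    have h2 := natDegree_mul_le_of_le (natDegree_eulerHirota_le hq') (natDegree_pow_le_of_le 2 hp')
    exact natDegree_sub_le_of_degree_le (by omega) (by omega)
  have e4' : d + 3 * d = 3 * d + d := by ring
  obtain ⟨h3, hc3⟩ := geom_sum_natDegree_le_and_coeff hp' hs' hpl hsl
  have ha : (p ^ 3 * q).coeff (d + 3 * d) = c ^ 3 * q.leadingCoeff ^ 4 := by
    rw [e4', coeff_mul_add_eq_of_natDegree_le (natDegree_pow_le_of_le 3 hp') hq',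
        coeff_pow_of_natDegree_le hp', hpl, hql]; ring
  have hb : (p * q ^ 3).coeff (d + 3 * d) = c * q.leadingCoeff ^ 4 := by
    rw [coeff_mul_add_eq_of_natDegree_le hp' (natDegree_pow_le_of_le 3 hq'),
        coeff_pow_of_natDegree_le hq', hpl, hql]; ring
  have hz := coeff_eq_zero_of_X_mul_eq key hdeg
  rw [coeff_add, coeff_add, coeff_ofNat_mul, coeff_mul_add_eq_of_natDegree_le hr h3, hc3,
    coeff_C_mul, coeff_C_mul, ha, hb] at hz
  have hl0 : q.leadingCoeff ^ 3 ≠ 0 := pow_ne_zero _ (leadingCoeff_ne_zero.2 hq)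
  refine (mul_eq_zero.1 (?_ : q.leadingCoeff ^ 3 * _ = 0)).resolve_left hl0
  linear_combination hz

lemma derivative_eval_sq_of_piiiPoly_eq_zero {α β a : ℂ} {p q : ℂ[X]} (ha : a ≠ 0)
    (hp : p.eval a ≠ 0) (hq : q.eval a = 0) (h : piiiPoly α β p q = 0) :
    (derivative q).eval a ^ 2 = (2 * p.eval a) ^ 2 := by
  have h1 := congrArg (eval a) h
  simp only [piiiPoly, eval_add, eval_sub, eval_mul, eval_pow, eval_X, eval_C, eval_ofNat, hq,
    eval_zero] at h1
  apply mul_left_cancel₀ (mul_ne_zero ha (pow_ne_zero 2 hp))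
  linear_combination h1

lemma derivative_eval_zero_of_piiiPoly_eq_zero {α β : ℂ} {p q : ℂ[X]}
    (hp : p.eval 0 ≠ 0) (hq : q.eval 0 = 0) (h : piiiPoly α β p q = 0) :
    α * (derivative q).eval 0 = -4 * p.eval 0 := by
  have h1 := congrArg (fun f => eval 0 (derivative f)) h
  simp only [piiiPoly, derivative_add, derivative_sub, derivative_mul, derivative_X, derivative_pow,
    derivative_C, derivative_ofNat, derivative_zero,
    eval_add, eval_sub, eval_mul, eval_pow, eval_X, eval_C, eval_ofNat, hq, eval_one,
    eval_zero] at h1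
  apply mul_left_cancel₀ (pow_ne_zero 3 hp)
  linear_combination -h1

lemma sum_eval_div_derivative_eval {q r : ℂ[X]} (hq : q ≠ 0)
    (hsimple : ∀ a, q.eval a = 0 → (derivative q).eval a ≠ 0)
    (hr : (X * r).natDegree ≤ q.natDegree) :
    ∑ a ∈ q.roots.toFinset, r.eval a / (derivative q).eval a
      = (X * r).coeff q.natDegree / q.leadingCoeff := by
  have hnd : q.roots.Nodup := by
    rw [Multiset.nodup_iff_count_le_one]
    intro a
    by_contra! hlt
    rw [count_roots, one_lt_rootMultiplicity_iff_isRoot hq] at hlt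
    exact hsimple a hlt.1 hlt.2
  have hcard : q.roots.toFinset.card = q.natDegree := by
    rw [Multiset.toFinset_card_of_nodup hnd]
    exact IsAlgClosed.card_roots_eq_natDegree
  have hprod : q = C q.leadingCoeff * Lagrange.nodal q.roots.toFinset id := by
    conv_lhs => rw [(IsAlgClosed.splits q).eq_prod_roots]
    rw [Lagrange.nodal_eq, Finset.prod, Multiset.toFinset_val, hnd.dedup]
    rfl
  rcases eq_or_ne r 0 with rfl | hr0
  · simp
  rw [natDegree_X_mul hr0] at hr
  obtain ⟨k, hk⟩ : ∃ k, q.natDegree = k + 1 := ⟨q.natDegree - 1, by omega⟩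
  have hdeg : r.degree < q.roots.toFinset.card := by
    rw [hcard]
    exact (natDegree_lt_iff_degree_lt hr0).1 (by omega)
  have := Lagrange.coeff_eq_sum (s := q.roots.toFinset) (v := id) Function.injective_id.injOn hdeg
  rw [hcard, hk, Nat.add_sub_cancel] at this
  rw [hk, coeff_X_mul, this, Finset.sum_div]
  refine Finset.sum_congr rfl fun a ha => ?_
  have hder : (derivative q).eval a
      = q.leadingCoeff * ∏ b ∈ q.roots.toFinset.erase a, (a - b) := by
    conv_lhs => rw [hprod]
    rw [derivative_C_mul, eval_C_mul]
    have := Lagrange.eval_nodal_derivative_eval_node_eq (v := id) ha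
    simp only [id] at this
    rw [this, Lagrange.eval_nodal]
    simp
  rw [hder, div_div, mul_comm]
  simp

lemma exists_int_sum_eq_div_two {s : Finset ℂ} {f : ℂ → ℂ}
    (h : ∀ a ∈ s, ∃ k : ℤ, f a = k / 2) : ∃ k : ℤ, ∑ a ∈ s, f a = k / 2 := by
  induction s using Finset.induction_on with
  | empty => exact ⟨0, by simp⟩
  | insert a s ha ih =>
    obtain ⟨k, hk⟩ := ih fun b hb => h b (Finset.mem_insert_of_mem hb)
    obtain ⟨l, hl⟩ := h a (Finset.mem_insert_self a s)
    exact ⟨l + k, by rw [Finset.sum_insert ha, hk, hl]; push_cast; ring⟩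

/-- If a rational solution tends to `±I` at infinity, comparing its residues shows that `m` is an
integer. -/
lemma exists_int_eq_of_leadingCoeff_sq_eq_neg_one {n : ℤ} {m c : ℂ} {p q : ℂ[X]} (hq : q ≠ 0)
    (hpq : IsCoprime p q) (hc : c ^ 2 = -1) (hd : p.natDegree = q.natDegree)
    (hl : p.leadingCoeff = c * q.leadingCoeff)
    (h : piiiPoly (4 * (n + m)) (4 * (n - m)) p q = 0) : ∃ k : ℤ, m = k := by
  have hc0 : c ≠ 0 := by rintro rfl; simp at hc
  have hql : q.leadingCoeff ≠ 0 := leadingCoeff_ne_zero.2 hq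
  have hinf := coeff_X_mul_sub_of_piiiPoly_eq_zero hq
    (by linear_combination (c ^ 2 - 1) * hc) hd hl h
  have hp0 : ∀ a, q.eval a = 0 → p.eval a ≠ 0 := by
    rintro a hqa hpa
    obtain ⟨u, v, huv⟩ := hpq
    simpa [hqa, hpa] using congrArg (eval a) huv
  have hzero : q.eval 0 = 0 → 4 * (n + m) * (derivative q).eval 0 = -4 * p.eval 0 :=
    fun h0 => derivative_eval_zero_of_piiiPoly_eq_zero (hp0 0 h0) h0 h
  have hsimple : ∀ a, q.eval a = 0 → (derivative q).eval a ≠ 0 := by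
    intro a hqa hda
    rcases eq_or_ne a 0 with rfl | ha
    · have := hzero hqa
      rw [hda] at this
      exact hp0 0 hqa (by linear_combination this / 4)
    · have := derivative_eval_sq_of_piiiPoly_eq_zero ha (hp0 a hqa) hqa h
      rw [hda] at this
      exact hp0 a hqa (by simpa using this.symm)
  have hsum := sum_eval_div_derivative_eval (r := p - C c * q) hq hsimple
    (natDegree_X_mul_sub_le hd.le (natDegree_C_mul_le _ _)
      (by rw [← hd, coeff_natDegree, hl, hd, coeff_C_mul, coeff_natDegree]))
  have hval : (X * (p - C c * q)).coeff q.natDegree / q.leadingCoeff = -m / 2 := by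
    rw [div_eq_iff hql]
    apply mul_left_cancel₀ hc0
    linear_combination (-1 / 16 : ℂ) * hinf + (c * (X * (p - C c * q)).coeff q.natDegree
      + (n + m) / 4 * c * q.leadingCoeff) * hc
  rw [hval] at hsum
  have hres : ∀ a, a ≠ 0 → q.eval a = 0 →
      ∃ k : ℤ, (p - C c * q).eval a / (derivative q).eval a = k / 2 := by
    intro a ha hqa
    have hq' := hsimple a hqa
    have hp' := hp0 a hqa
    simp only [eval_sub, eval_mul, hqa, mul_zero, sub_zero]
    rcases sq_eq_sq_iff_eq_or_eq_neg.1
      (derivative_eval_sq_of_piiiPoly_eq_zero ha hp' hqa h) with h1 | h1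
    · exact ⟨1, by rw [h1]; field_simp; norm_num⟩
    · exact ⟨-1, by rw [h1]; field_simp; norm_num⟩
  obtain ⟨k, hk⟩ := exists_int_sum_eq_div_two (s := q.roots.toFinset.erase 0)
    (f := fun a => (p - C c * q).eval a / (derivative q).eval a) fun a ha => by
      rw [Finset.mem_erase, Multiset.mem_toFinset, mem_roots hq] at ha
      exact hres a ha.1 ha.2
  by_cases h0 : (0 : ℂ) ∈ q.roots.toFinset
  · rw [← Finset.add_sum_erase _ _ h0, hk] at hsum
    rw [Multiset.mem_toFinset, mem_roots hq] at h0
    have hq0 : q.eval 0 = 0 := h0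
    have hres0 : (p - C c * q).eval 0 / (derivative q).eval 0 = -(n + m) := by
      rw [div_eq_iff (hsimple 0 hq0)]
      simp only [eval_sub, eval_mul, hq0, mul_zero, sub_zero]
      linear_combination hzero hq0 / 4
    rw [hres0] at hsum
    exact ⟨k - 2 * n, by push_cast; linear_combination -2 * hsum⟩
  · rw [Finset.erase_eq_of_notMem h0] at hk
    rw [hk] at hsum
    exact ⟨-k, by push_cast; linear_combination 2 * hsum⟩

lemma X_mul_piiiPoly_eq_of_wronskian {α β : ℂ} {p q W : ℂ[X]}
    (hW : X * (derivative p * q - derivative q * p) = W) :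
    X * piiiPoly α β p q = p * q * (X * derivative W) - W * (X * derivative (p * q))
      - X * (C α * p ^ 3 * q + C β * p * q ^ 3) - 4 * X ^ 2 * (p ^ 4 - q ^ 4) := by
  subst hW
  simp only [piiiPoly, derivative_mul, derivative_sub, derivative_X]
  ring

/-- The factor common to numerator and denominator of the Bäcklund transformation. -/
noncomputable def backlundFactor (a : ℂ) (p q : ℂ[X]) : ℂ[X] :=
  X * (derivative p * q - derivative q * p) + 2 * X * (p ^ 2 + q ^ 2) + C a * p * q

/-- The Bäcklund transformation `(Θ₀, Θ∞) ↦ (Θ₀ + 1, Θ∞ - 1)`. -/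
lemma piiiPoly_backlund {a b : ℂ} {p q : ℂ[X]} (h : piiiPoly (2 * a - 2) (2 * b - 2) p q = 0) :
    piiiPoly (2 * a + 2) (2 * b + 2) (q * backlundFactor (-b) p q)
      (p * backlundFactor a p q) = 0 := by
  obtain ⟨T, hT⟩ : ∃ T, X * (derivative p * q - derivative q * p) = T - 2 * X * (p ^ 2 + q ^ 2) :=
    ⟨X * (derivative p * q - derivative q * p) + 2 * X * (p ^ 2 + q ^ 2), by ring⟩
  obtain ⟨A, hA⟩ : ∃ A, A = backlundFactor a p q := ⟨_, rfl⟩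
  obtain ⟨B, hB⟩ : ∃ B, B = backlundFactor (-b) p q := ⟨_, rfl⟩
  rw [← hA, ← hB]
  replace hA : A = T + C a * p * q := by rw [hA, backlundFactor, hT]; ring
  replace hB : B = T - C b * p * q := by rw [hB, backlundFactor, hT, C_neg]; ring
  have hT' : p * q * (X * derivative T) - T * (X * (derivative p * q + p * derivative q)) =
      2 * X * (p ^ 2 * A - q ^ 2 * B) := by
    have h1 := X_mul_piiiPoly_eq_of_wronskian (α := 2 * a - 2) (β := 2 * b - 2) hT
    rw [h] at h1
    simp only [derivative_mul, derivative_sub, derivative_add, derivative_X, derivative_pow,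
      derivative_ofNat, C_sub, C_mul, C_ofNat] at h1
    push_cast at h1
    simp only [map_ofNat] at h1
    rw [hA, hB]
    linear_combination -h1 + 2 * X * (p ^ 2 - q ^ 2) * hT
  have hA' : derivative A = derivative T + C a * (derivative p * q + p * derivative q) := by
    rw [hA]; simp only [derivative_mul, derivative_add, derivative_C]; ring
  have hB' : derivative B = derivative T - C b * (derivative p * q + p * derivative q) := by
    rw [hB]; simp only [derivative_mul, derivative_sub, derivative_C]; ring
  have hW : X * (derivative (q * B) * (p * A) - derivative (p * A) * (q * B)) =
      2 * X * ((q * B) ^ 2 + (p * A) ^ 2) - T * A * B := by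
    have hAB : derivative B * A - B * derivative A =
        (C a + C b) * (p * q * derivative T - T * (derivative p * q + p * derivative q)) := by
      rw [hA', hB', hA, hB]; ring
    have hsub : (C a + C b) * (p * q) = A - B := by rw [hA, hB]; ring
    simp only [derivative_mul]
    linear_combination -(A * B) * hT + (C a + C b) * (p * q) * hT' + X * (p * q) * hAB
      + 2 * X * (p ^ 2 * A - q ^ 2 * B) * hsub
  have hX := X_mul_piiiPoly_eq_of_wronskian (α := 2 * a + 2) (β := 2 * b + 2) hW
  refine (mul_eq_zero.1 (hX.trans ?_)).resolve_left X_ne_zero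
  have ha : C a * (p * q) = A - T := by rw [hA]; ring
  have hb : C b * (p * q) = T - B := by rw [hB]; ring
  simp only [derivative_mul, derivative_sub, derivative_add, derivative_X, derivative_pow,
    derivative_ofNat, C_add, C_mul, C_ofNat] at hW ⊢
  push_cast
  simp only [map_ofNat]
  linear_combination 2 * X * ((q * B) ^ 2 - (p * A) ^ 2) * hW - (A * B) ^ 2 * hT'
    - 2 * X * A * B * ((q * B) ^ 2 * ha + (p * A) ^ 2 * hb)

lemma natDegree_backlundFactor {a l : ℂ} {p q : ℂ[X]} {d : ℕ} (hp : p.natDegree = d)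
    (hq : q.natDegree = d) (hpl : p.leadingCoeff = l) (hql : q.leadingCoeff = l) (hl : l ≠ 0) :
    (backlundFactor a p q).natDegree = 2 * d + 1 ∧
      (backlundFactor a p q).leadingCoeff = 4 * l ^ 2 := by
  have hpc : p.coeff d = l := by rw [← hp]; exact hpl
  have hqc : q.coeff d = l := by rw [← hq]; exact hql
  have hR : (X * derivative p * q - X * derivative q * p + C a * p * q).natDegree ≤ 2 * d := by
    have h1 := natDegree_mul_le_of_le (natDegree_X_mul_derivative_le_of_le hp.le) hq.le
    have h2 := natDegree_mul_le_of_le (natDegree_X_mul_derivative_le_of_le hq.le) hp.le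
    have h3 := natDegree_mul_le_of_le (natDegree_mul_le_of_le (natDegree_C a).le hp.le) hq.le
    exact natDegree_add_le_of_degree_le (natDegree_sub_le_of_degree_le (by omega) (by omega))
      (by omega)
  have hS : (p ^ 2 + q ^ 2).natDegree ≤ 2 * d :=
    natDegree_add_le_of_degree_le (natDegree_pow_le_of_le 2 hp.le) (natDegree_pow_le_of_le 2 hq.le)
  have hS' : (X * (C 2 * (p ^ 2 + q ^ 2))).natDegree ≤ 2 * d + 1 :=
    (natDegree_mul_le_of_le natDegree_X_le (natDegree_mul_le_of_le (natDegree_C 2).le hS)).trans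
      (by omega)
  have heq : backlundFactor a p q = X * (C 2 * (p ^ 2 + q ^ 2))
      + (X * derivative p * q - X * derivative q * p + C a * p * q) := by
    rw [backlundFactor, C_ofNat]; ring
  have hdeg : (backlundFactor a p q).natDegree ≤ 2 * d + 1 := by
    rw [heq]; exact natDegree_add_le_of_degree_le hS' (hR.trans (by omega))
  have hcoeff : (backlundFactor a p q).coeff (2 * d + 1) = 4 * l ^ 2 := by
    rw [heq, coeff_add, coeff_eq_zero_of_natDegree_lt (hR.trans_lt (by omega)), coeff_X_mul,
      coeff_C_mul, coeff_add, coeff_pow_of_natDegree_le hp.le, coeff_pow_of_natDegree_le hq.le,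
      hpc, hqc]
    ring
  have hd := le_antisymm hdeg (le_natDegree_of_ne_zero (by rw [hcoeff]; simp [hl]))
  exact ⟨hd, by rw [leadingCoeff, hd, hcoeff]⟩

/-- A solution tending to `1` at infinity, for natural `n`. -/
lemma exists_piiiPoly_eq_zero_nat (m : ℂ) (n : ℕ) : ∃ p q : ℂ[X], p ≠ 0 ∧ q ≠ 0 ∧
    p.natDegree = q.natDegree ∧ p.leadingCoeff = q.leadingCoeff ∧
    piiiPoly (4 * (n + m)) (4 * (n - m)) p q = 0 := by
  induction n with
  | zero =>
    refine ⟨1, 1, one_ne_zero, one_ne_zero, rfl, rfl, ?_⟩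
    simp [piiiPoly]
  | succ n ih =>
    obtain ⟨p, q, hp, hq, hd, hl, h⟩ := ih
    have hl0 := leadingCoeff_ne_zero.2 hq
    obtain ⟨dA, lA⟩ := natDegree_backlundFactor (a := 2 * (n + m) + 1) hd rfl hl rfl hl0
    obtain ⟨dB, lB⟩ := natDegree_backlundFactor (a := -(2 * (n - m) + 1)) hd rfl hl rfl hl0
    have hA : backlundFactor (2 * (n + m) + 1) p q ≠ 0 := by
      rw [← leadingCoeff_ne_zero, lA]; simp [hq]
    have hB : backlundFactor (-(2 * (n - m) + 1)) p q ≠ 0 := by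
      rw [← leadingCoeff_ne_zero, lB]; simp [hq]
    refine ⟨_, _, mul_ne_zero hq hB, mul_ne_zero hp hA, ?_, ?_, ?_⟩
    · rw [natDegree_mul hq hB, natDegree_mul hp hA, dA, dB, hd]
    · rw [leadingCoeff_mul, leadingCoeff_mul, lA, lB, hl]
    · convert piiiPoly_backlund (a := 2 * (n + m) + 1) (b := 2 * (n - m) + 1) (p := p) (q := q) ?_
        using 1
      · congr 1 <;> push_cast <;> ring
      · convert h using 2 <;> ring

/-- A solution tending to `1` at infinity, for integer `n`. -/
lemma exists_piiiPoly_eq_zero (m : ℂ) (n : ℤ) : ∃ p q : ℂ[X], p ≠ 0 ∧ q ≠ 0 ∧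
    p.natDegree = q.natDegree ∧ p.leadingCoeff = q.leadingCoeff ∧
    piiiPoly (4 * (n + m)) (4 * (n - m)) p q = 0 := by
  obtain ⟨k, rfl | rfl⟩ := n.eq_nat_or_neg
  · simpa using exists_piiiPoly_eq_zero_nat m k
  · obtain ⟨p, q, hp, hq, hd, hl, h⟩ := exists_piiiPoly_eq_zero_nat m k
    refine ⟨q, p, hq, hp, hd.symm, hl.symm, ?_⟩
    rw [piiiPoly_swap, neg_eq_zero]
    convert h using 2 <;> push_cast <;> ring

lemma PIIIat_iff {Θ0 Θinf x : ℂ} {p q : ℂ[X]} (hx : x ≠ 0) (hp : p.eval x ≠ 0)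
    (hq : q.eval x ≠ 0) :
    PIIIat Θ0 Θinf (fun y => p.eval y / q.eval y) x ↔
      (piiiPoly (4 * Θ0) (4 * (1 - Θinf)) p q).eval x = 0 := by
  have hd : ∀ y, q.eval y ≠ 0 → deriv (fun y => p.eval y / q.eval y) y =
      (derivative p * q - p * derivative q).eval y / (q ^ 2).eval y := by
    intro y hy
    refine ((p.hasDerivAt y).div (q.hasDerivAt y) hy).deriv.trans ?_
    simp
  have hev : deriv (fun y => p.eval y / q.eval y) =ᶠ[nhds x]
      fun y => (derivative p * q - p * derivative q).eval y / (q ^ 2).eval y := by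
    filter_upwards [q.continuous.continuousAt.eventually_ne hq] with y hy using hd y hy
  have hq2 : (q ^ 2).eval x ≠ 0 := by simpa using hq
  have hdd : deriv (deriv fun y => p.eval y / q.eval y) x = _ :=
    hev.deriv_eq.trans
      (((derivative p * q - p * derivative q).hasDerivAt x).div ((q ^ 2).hasDerivAt x) hq2).deriv
  rw [PIIIat, hdd, hd x hq, ← sub_eq_zero]
  have hden : x * p.eval x * q.eval x ^ 3 ≠ 0 := mul_ne_zero (mul_ne_zero hx hp) (pow_ne_zero 3 hq)
  refine Iff.trans (Eq.congr_left ?_) (div_eq_zero_iff.trans (or_iff_left hden))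
  simp only [piiiPoly, derivative_mul, derivative_sub, derivative_pow, eval_add, eval_sub, eval_mul,
    eval_pow, eval_X, eval_C, eval_ofNat]
  push_cast
  field_simp
  ring

lemma isRatSolutionPIII_iff {Θ0 Θinf : ℂ} {p q : ℂ[X]} :
    IsRatSolutionPIII Θ0 Θinf p q ↔
      p ≠ 0 ∧ q ≠ 0 ∧ piiiPoly (4 * Θ0) (4 * (1 - Θinf)) p q = 0 := by
  refine and_congr_right fun hp => and_congr_right fun hq => ⟨fun h => ?_, fun h x hx hpx hqx => ?_⟩
  · have hz : X * p * q * piiiPoly (4 * Θ0) (4 * (1 - Θinf)) p q = 0 := by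
      refine Polynomial.funext fun x => ?_
      by_cases hx : x = 0
      · simp [hx]
      by_cases hpx : p.eval x = 0
      · simp [hpx]
      by_cases hqx : q.eval x = 0
      · simp [hqx]
      simp [(PIIIat_iff hx hpx hqx).1 (h x hx hpx hqx)]
    simpa [X_ne_zero, hp, hq] using hz
  · rw [PIIIat_iff hx hpx hqx, h, eval_zero]

/-- For non-integer `m`, a rational solution tends to `1` or `-1` at infinity. -/
lemma leadingCoeff_eq_or_eq_neg {n : ℤ} {m : ℂ} (hm : ¬∃ k : ℤ, m = k) {p q : ℂ[X]} (hp : p ≠ 0)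
    (hq : q ≠ 0) (h : piiiPoly (4 * (n + m)) (4 * (n - m)) p q = 0) :
    p.leadingCoeff = q.leadingCoeff ∨ p.leadingCoeff = -q.leadingCoeff := by
  obtain ⟨hd, hl⟩ := natDegree_eq_and_leadingCoeff_pow_four_eq hp hq h
  rw [← sq_eq_sq_iff_eq_or_eq_neg]
  by_contra hne
  have hneg : p.leadingCoeff ^ 2 = -q.leadingCoeff ^ 2 := by
    apply mul_left_cancel₀ (sub_ne_zero.2 hne)
    linear_combination hl
  obtain ⟨p', q', hp', hq', hu⟩ := extract_gcd p q
  have hg : gcd p q ≠ 0 := fun h0 => hp ((gcd_eq_zero_iff _ _).1 h0).1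
  generalize gcd p q = g at hp' hq' hg
  have hgl := leadingCoeff_ne_zero.2 hg
  have hp0 : p' ≠ 0 := by rintro rfl; exact hp (by simpa using hp')
  have hq0 : q' ≠ 0 := by rintro rfl; exact hq (by simpa using hq')
  have h' : piiiPoly (4 * (n + m)) (4 * (n - m)) p' q' = 0 := by
    rw [hp', hq', piiiPoly_mul_left] at h
    exact (mul_eq_zero.1 h).resolve_left (pow_ne_zero 4 hg)
  rw [hp', hq', leadingCoeff_mul, leadingCoeff_mul] at hneg
  have hql := leadingCoeff_ne_zero.2 hq0
  refine hm (exists_int_eq_of_leadingCoeff_sq_eq_neg_one (c := p'.leadingCoeff / q'.leadingCoeff)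
    hq0 ((gcd_isUnit_iff _ _).1 hu) ?_ (natDegree_eq_and_leadingCoeff_pow_four_eq hp0 hq0 h').1
    (div_mul_cancel₀ _ hql).symm h')
  rw [div_pow, div_eq_iff (pow_ne_zero 2 hql)]
  apply mul_left_cancel₀ (pow_ne_zero 2 hgl)
  linear_combination hneg

/-- For `n ∈ ℤ` and `m ∉ ℤ`, Painlevé-III with `Θ0 = n + m`, `Θinf = m - n + 1`
has exactly two rational solutions `u₁ = p₁/q₁ ≠ u₂ = p₂/q₂`, related by
`u₂(x) = -u₁(-x)`; equality of rational functions is expressed by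
cross-multiplication of numerators and denominators. -/
theorem exactly_two_rational_solutions (n : ℤ) (m : ℂ) (hm : ¬∃ k : ℤ, m = k) :
    ∃ p₁ q₁ p₂ q₂ : Polynomial ℂ,
      IsRatSolutionPIII ((n : ℂ) + m) (m - (n : ℂ) + 1) p₁ q₁ ∧
      IsRatSolutionPIII ((n : ℂ) + m) (m - (n : ℂ) + 1) p₂ q₂ ∧
      p₁ * q₂ ≠ p₂ * q₁ ∧
      p₂ * q₁.comp (-Polynomial.X) = -(p₁.comp (-Polynomial.X)) * q₂ ∧
      ∀ p q : Polynomial ℂ, IsRatSolutionPIII ((n : ℂ) + m) (m - (n : ℂ) + 1) p q →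
        p * q₁ = p₁ * q ∨ p * q₂ = p₂ * q := by
  have hα : 4 * (1 - (m - (n : ℂ) + 1)) = 4 * (n - m) := by ring
  simp only [isRatSolutionPIII_iff, hα]
  obtain ⟨p, q, hp, hq, hd, hl, h⟩ := exists_piiiPoly_eq_zero m n
  have hcomp : ∀ f : ℂ[X], f ≠ 0 → f.comp (-X) ≠ 0 := fun f hf => by
    rwa [Ne, comp_neg_X_eq_zero_iff]
  have h2 : piiiPoly (4 * (n + m)) (4 * (n - m)) (-(p.comp (-X))) (q.comp (-X)) = 0 := by
    rw [piiiPoly_neg_comp, h, zero_comp, neg_zero]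
  have hd2 : (-(p.comp (-X))).natDegree = (q.comp (-X)).natDegree := by
    rw [natDegree_neg, natDegree_comp, natDegree_comp, hd]
  have hl2 : (-(p.comp (-X))).leadingCoeff = -1 * (q.comp (-X)).leadingCoeff := by
    rw [leadingCoeff_neg, leadingCoeff_comp (by simp), leadingCoeff_comp (by simp), hd, hl,
      neg_one_mul]
  have hq2 := hcomp q hq
  refine ⟨p, q, -(p.comp (-X)), q.comp (-X), ⟨hp, hq, h⟩,
    ⟨neg_ne_zero.2 (hcomp p hp), hq2, h2⟩, fun he => ?_, rfl, fun P Q ⟨hP, hQ, H⟩ => ?_⟩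
  · have he' := congrArg leadingCoeff he
    rw [leadingCoeff_mul, leadingCoeff_mul, hl, hl2] at he'
    have : q.leadingCoeff * (q.comp (-X)).leadingCoeff = 0 := by linear_combination he' / 2
    exact mul_ne_zero (leadingCoeff_ne_zero.2 hq) (leadingCoeff_ne_zero.2 hq2) this
  · have hD := (natDegree_eq_and_leadingCoeff_pow_four_eq hP hQ H).1
    rcases leadingCoeff_eq_or_eq_neg hm hP hQ H with hL | hL
    · exact Or.inl (mul_eq_mul_of_leadingCoeff hQ hq one_ne_zero hD hd (by rw [hL, one_mul])
        (by rw [hl, one_mul]) H h)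
    · exact Or.inr (mul_eq_mul_of_leadingCoeff hQ hq2 (neg_ne_zero.2 one_ne_zero) hD hd2
        (by rw [hL, neg_one_mul]) hl2 H h2)
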